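/- Let L and H be finite-dimensional p-nilpotent restricted Lie algebras over a perfect field F of characteristic p > 0, let φ : u(L) → u(H) be an algebra isomorphism with φ(ω(L)) = ω(H), and let E ⊆ u(L) be as in the context. Then ω(H)/J_H = (H + J_H)/J_H ⊕ φ(E)/J_H as F-vector spaces. -/

import Mathlib

open UniversalEnvelopingAlgebra

attribute [local instance 100] LieRing.ofAssociativeRing

/-- A restricted Lie algebra over a field `F` of characteristic `p`: a Lie algebra equipped
with a `p`-map `x ↦ x^[p]` satisfying Jacobson's identities.  The additive identity
`(x+y)^[p] = x^[p] + y^[p] + Σ sᵢ(x,y)` (with `sᵢ` the Jacobson polynomials) is expressed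
faithfully inside the universal enveloping algebra, where it reads
`ι((x+y)^[p]) - ι(x^[p]) - ι(y^[p]) = (ι x + ι y)^p - (ι x)^p - (ι y)^p`. -/
class RestrictedLieAlgebra (p : ℕ) (F : Type*) (L : Type*) [Field F]
    [LieRing L] [LieAlgebra F L] : Type _ where
  pOp : L → L
  pOp_smul : ∀ (a : F) (x : L), pOp (a • x) = a ^ p • pOp x
  ad_pOp : ∀ x y : L, ⁅pOp x, y⁆ = ((LieAlgebra.ad F L x) ^ p) y
  pOp_add : ∀ x y : L,
    ι F (pOp (x + y)) - ι F (pOp x) - ι F (pOp y)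
      = (ι F x + ι F y) ^ p - (ι F x) ^ p - (ι F y) ^ p

namespace RestrictedLieAlgebra

variable (p : ℕ) (F : Type*) [Field F]

section Defs

variable (L : Type*) [LieRing L] [LieAlgebra F L] [RestrictedLieAlgebra p F L]

/-- The `p`-map of a restricted Lie algebra. -/
abbrev pmap (x : L) : L := RestrictedLieAlgebra.pOp (p := p) (F := F) x

/-- The relation defining the restricted enveloping algebra as a quotient of the
universal enveloping algebra: `x^p = x^[p]` for all `x ∈ L`. -/
def uRel : UniversalEnvelopingAlgebra F L → UniversalEnvelopingAlgebra F L → Prop :=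
  fun a b => ∃ x : L, a = (ι F x) ^ p ∧ b = ι F (pmap p F L x)

/-- The restricted enveloping algebra `u(L)`: the quotient of the universal enveloping
algebra of `L` by the two-sided ideal generated by `{x^p - x^[p] : x ∈ L}`. -/
abbrev uEnv := RingQuot (uRel p F L)

/-- The canonical (linear) embedding `L → u(L)`. -/
def uemb : L →ₗ[F] uEnv p F L :=
  ((RingQuot.mkAlgHom F (uRel p F L)).toLinearMap).comp (ι F : L →ₗ⁅F⁆ _).toLinearMap

variable [Fact p.Prime]

/-- The augmentation map `ε : u(L) → F`, induced by `x ↦ 0` for `x ∈ L`. -/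
noncomputable def aug : uEnv p F L →ₐ[F] F :=
  RingQuot.liftAlgHom F
    ⟨(UniversalEnvelopingAlgebra.lift F) (0 : L →ₗ⁅F⁆ F), by
      rintro a b ⟨x, rfl, rfl⟩
      simp [UniversalEnvelopingAlgebra.lift_ι_apply,
        zero_pow (Nat.Prime.ne_zero (Fact.out : p.Prime))]⟩

/-- The augmentation ideal `ω(L)`, i.e. the kernel of the augmentation map, as a
subspace of `u(L)`. -/
noncomputable def omegaIdeal : Submodule F (uEnv p F L) :=
  LinearMap.ker (aug p F L).toLinearMap

/-- The image of `L` inside `u(L)`. -/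
def lSub : Submodule F (uEnv p F L) := LinearMap.range (uemb p F L)

end Defs

section Closure

variable {L : Type*} [LieRing L] [LieAlgebra F L] [RestrictedLieAlgebra p F L]

/-- The restricted subalgebra generated by a subset `S` of `L`: the smallest Lie
subalgebra containing `S` which is closed under the `p`-map. -/
def restrictedClosure (S : Set L) : LieSubalgebra F L :=
  sInf {K : LieSubalgebra F L | S ⊆ K ∧ ∀ x ∈ K, pmap p F L x ∈ K}

/-- For a subalgebra `N ⊆ L`, the restricted subalgebra `N^p` generated by all
`x^[p]`, `x ∈ N`. -/
def subPPow (K : LieSubalgebra F L) : LieSubalgebra F L :=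
  restrictedClosure p F (pmap p F L '' K)

end Closure

section PNilpotent

variable (L : Type*) [LieRing L] [LieAlgebra F L] [RestrictedLieAlgebra p F L]

/-- `L` is `p`-nilpotent if `L^{pˢ} = 0` for some `s`, where `L^p` denotes the restricted
subalgebra generated by all `x^[p]`. -/
def IsPNilpotent : Prop :=
  ∃ s : ℕ, (subPPow p F)^[s] (⊤ : LieSubalgebra F L) = ⊥

/-- The derived subalgebra `L' = γ₂(L)` as a submodule of `L`. -/
abbrev derivedSub : Submodule F L := (LieModule.lowerCentralSeries F L L 1).toSubmodule

/-- `L'_p`, the restricted subalgebra generated by `L'`, as a submodule. -/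
def derivedP : Submodule F L :=
  (restrictedClosure p F (derivedSub F L : Set L)).toSubmodule

/-- `L'^p + γ₃(L)`, as a submodule of `L`. -/
def mainIdeal : Submodule F L :=
  (subPPow p F (restrictedClosure p F (derivedSub F L : Set L))).toSubmodule
    ⊔ (LieModule.lowerCentralSeries F L L 2).toSubmodule

end PNilpotent

end RestrictedLieAlgebra

namespace RestrictedLieAlgebra

section Setup

variable (p : ℕ) (F : Type*) [Field F] [Fact p.Prime]
variable (L : Type*) [LieRing L] [LieAlgebra F L] [RestrictedLieAlgebra p F L]

/-- The ideal `J_L = ω(L)L' + L'ω(L)` of `u(L)`, as a subspace. -/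
noncomputable def jIdeal : Submodule F (uEnv p F L) :=
  omegaIdeal p F L * ((derivedSub F L).map (uemb p F L))
    + ((derivedSub F L).map (uemb p F L)) * omegaIdeal p F L

/-- The subspace `E` of `u(L)`: the span of `J_L` together with all PBW monomials of
degree at least two in the fixed set `X` of representatives. -/
noncomputable def eSpace (n : ℕ) (ex : Fin n → ℕ) (X : (i : Fin n) → Fin (ex i) → L) :
    Submodule F (uEnv p F L) :=
  jIdeal p F L ⊔
    Submodule.span F
      {u : uEnv p F L | ∃ a : (i : Fin n) → Fin (ex i) → ℕ,
        (∀ i j, a i j < p) ∧ 2 ≤ ∑ i, ∑ j, a i j ∧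
        u = ((List.finRange n).map (fun i =>
              ((List.finRange (ex i)).map
                (fun j => uemb p F L (X i j) ^ a i j)).prod)).prod}

/-- The data `e₁, …, e_n ∈ L` together with exponents `ex i = exp(ēᵢ)` and a set `X` of
coset representatives, expressing the decomposition
`L/L'_p = ⟨ē₁⟩_p ⊕ ⋯ ⊕ ⟨ē_n⟩_p` via the resulting basis `ēᵢ^{[p]^j}` (`0 ≤ j < ex i`)
of `L/L'_p`. -/
def GoodPresentation (n : ℕ) (e : Fin n → L) (ex : Fin n → ℕ)
    (X : (i : Fin n) → Fin (ex i) → L) : Prop :=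
  LinearIndependent F
    (fun q : Σ i : Fin n, Fin (ex i) =>
      (Submodule.Quotient.mk ((pmap p F L)^[(q.2 : ℕ)] (e q.1)) : L ⧸ derivedP p F L)) ∧
  Submodule.span F
    (Set.range (fun q : Σ i : Fin n, Fin (ex i) =>
      (Submodule.Quotient.mk ((pmap p F L)^[(q.2 : ℕ)] (e q.1)) : L ⧸ derivedP p F L))) = ⊤ ∧
  (∀ i, (pmap p F L)^[ex i] (e i) ∈ derivedP p F L) ∧
  (∀ i (j : Fin (ex i)), X i j - (pmap p F L)^[(j : ℕ)] (e i) ∈ derivedP p F L)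

end Setup

end RestrictedLieAlgebra

namespace RestrictedLieAlgebra

section Enveloping

variable (p : ℕ) (F : Type*) [Field F]
variable (L : Type*) [LieRing L] [LieAlgebra F L] [RestrictedLieAlgebra p F L]

theorem uemb_pmap (x : L) : uemb p F L (pmap p F L x) = uemb p F L x ^ p := by
  refine Eq.trans ?_ (map_pow (RingQuot.mkAlgHom F (uRel p F L)) (ι F x) p)
  exact (RingQuot.mkAlgHom_rel F ⟨x, rfl, rfl⟩).symm

theorem uemb_pmap_iterate (x : L) (j : ℕ) :
    uemb p F L ((pmap p F L)^[j] x) = uemb p F L x ^ p ^ j := by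
  induction j with
  | zero => simp
  | succ j ih => rw [Function.iterate_succ_apply', uemb_pmap, ih, ← pow_mul, pow_succ]

theorem uemb_lie (x y : L) :
    uemb p F L ⁅x, y⁆ = uemb p F L x * uemb p F L y - uemb p F L y * uemb p F L x := by
  simp [uemb, LieRing.of_associative_ring_bracket]

theorem adjoin_range_uemb : Algebra.adjoin F (Set.range (uemb p F L)) = ⊤ := by
  let q := (RingQuot.mkAlgHom F (uRel p F L)).comp (UniversalEnvelopingAlgebra.mkAlgHom F L)
  have hq : Function.Surjective q :=
    (RingQuot.mkAlgHom_surjective F _).comp Quotient.mk_surjective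
  have hrange : Set.range (uemb p F L) = q '' Set.range (TensorAlgebra.ι F) := by
    rw [← Set.range_comp]
    rfl
  rw [hrange, ← AlgHom.map_adjoin, TensorAlgebra.adjoin_range_ι, Algebra.map_top,
    AlgHom.range_eq_top]
  exact hq

variable {p F L} in
theorem uEnv_algHom_ext {C : Type*} [Semiring C] [Algebra F C] {f g : uEnv p F L →ₐ[F] C}
    (h : ∀ x, f (uemb p F L x) = g (uemb p F L x)) : f = g :=
  AlgHom.ext_of_adjoin_eq_top (adjoin_range_uemb p F L) (by rintro _ ⟨x, rfl⟩; exact h x)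

variable {p F L} in
/-- A property of elements of `u(L)` that holds for scalars and `L`, and is stable under sums and
products, holds everywhere. -/
theorem uEnv_induction {P : uEnv p F L → Prop} (emb : ∀ x, P (uemb p F L x))
    (scalar : ∀ c, P (algebraMap F _ c)) (add : ∀ a b, P a → P b → P (a + b))
    (mul : ∀ a b, P a → P b → P (a * b)) (a : uEnv p F L) : P a := by
  have ha : a ∈ Algebra.adjoin F (Set.range (uemb p F L)) := by
    rw [adjoin_range_uemb]; exact Algebra.mem_top
  induction ha using Algebra.adjoin_induction with
  | mem x hx => obtain ⟨x, rfl⟩ := hx; exact emb x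
  | algebraMap c => exact scalar c
  | add a b _ _ ha hb => exact add a b ha hb
  | mul a b _ _ ha hb => exact mul a b ha hb

theorem derivedSub_eq_span : derivedSub F L = Submodule.span F {z | ∃ x y : L, ⁅x, y⁆ = z} := by
  simp [derivedSub, LieModule.lowerCentralSeries_succ, LieSubmodule.lieIdeal_oper_eq_linear_span']

variable {p F L} in
theorem mem_derivedP {x : L} : x ∈ derivedP p F L ↔ ∀ K : LieSubalgebra F L,
    (derivedSub F L : Set L) ⊆ K → (∀ y ∈ K, pmap p F L y ∈ K) → x ∈ K := by
  rw [derivedP, LieSubalgebra.mem_toSubmodule, restrictedClosure, ← SetLike.mem_coe,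
    LieSubalgebra.coe_sInf]
  simp

theorem derivedSub_le_derivedP : derivedSub F L ≤ derivedP p F L :=
  fun _ hx => mem_derivedP.mpr fun _ hK _ => hK hx

variable {p F L} in
theorem pmap_mem_derivedP {x : L} (hx : x ∈ derivedP p F L) :
    pmap p F L x ∈ derivedP p F L :=
  mem_derivedP.mpr fun K hK hpow => hpow _ (mem_derivedP.mp hx K hK hpow)

variable {p F L} in
/-- Homomorphisms from `u(L)` to commutative algebras vanish on `L'_p`. -/
theorem algHom_uemb_eq_zero (hp : p ≠ 0) {C : Type*} [CommRing C] [Algebra F C]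
    (χ : uEnv p F L →ₐ[F] C) {x : L} (hx : x ∈ derivedP p F L) : χ (uemb p F L x) = 0 := by
  have hlie : ∀ x y : L, χ (uemb p F L ⁅x, y⁆) = 0 := fun x y => by
    rw [uemb_lie, map_sub, map_mul, map_mul, mul_comm, sub_self]
  let K : LieSubalgebra F L :=
    { LinearMap.ker (χ.toLinearMap ∘ₗ uemb p F L) with lie_mem' := fun _ _ => hlie _ _ }
  have hK : ∀ {x}, x ∈ K ↔ χ (uemb p F L x) = 0 := Iff.rfl
  refine hK.mp (mem_derivedP.mp hx K ?_ fun y hy => ?_)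
  · have hle : derivedSub F L ≤ K.toSubmodule := by
      rw [derivedSub_eq_span, Submodule.span_le]
      rintro _ ⟨x, y, rfl⟩
      exact hlie x y
    exact hle
  · rw [hK] at hy ⊢
    rw [uemb_pmap, map_pow, hy, zero_pow hp]

section Lift

variable {p F L}
variable {C : Type*} [CommRing C] [Algebra F C] (f : L →ₗ[F] C)
  (hlie : ∀ x y : L, f ⁅x, y⁆ = 0)

/-- A linear map to a commutative algebra that vanishes on brackets is a Lie homomorphism. -/
def lieHomOfComm : L →ₗ⁅F⁆ C :=
  { f with
    map_lie' := fun {x y} => by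
      rw [LieRing.of_associative_ring_bracket, mul_comm, sub_self]
      exact hlie x y }

theorem map_pmap_add [Fact p.Prime] [CharP F p] (hlie : ∀ x y : L, f ⁅x, y⁆ = 0) (x y : L) :
    f (pmap p F L (x + y)) = f (pmap p F L x) + f (pmap p F L y) := by
  have h := congrArg (UniversalEnvelopingAlgebra.lift F (lieHomOfComm f hlie))
    (RestrictedLieAlgebra.pOp_add (p := p) (F := F) x y)
  have hι : ∀ z, UniversalEnvelopingAlgebra.lift F (lieHomOfComm f hlie) (ι F z) = f z :=
    fun z => UniversalEnvelopingAlgebra.lift_ι_apply F _ z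
  simp only [map_sub, map_pow, map_add, hι] at h
  have hpow : (f x + f y) ^ p = f x ^ p + f y ^ p := by
    cases subsingleton_or_nontrivial C
    · exact Subsingleton.elim _ _
    · have := charP_of_injective_algebraMap (algebraMap F C).injective p
      exact add_pow_char _ _ _
  rw [hpow, add_sub_cancel_left, sub_self, sub_sub, sub_eq_zero] at h
  exact h

/-- The homomorphism from `u(L)` to a commutative algebra induced by a linear map which vanishes
on brackets and is compatible with `p`-th powers. -/
noncomputable def uLift (hpow : ∀ x, f (pmap p F L x) = f x ^ p) : uEnv p F L →ₐ[F] C :=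
  RingQuot.liftAlgHom F ⟨UniversalEnvelopingAlgebra.lift F (lieHomOfComm f hlie), by
    rintro _ _ ⟨x, rfl, rfl⟩
    rw [map_pow, UniversalEnvelopingAlgebra.lift_ι_apply, UniversalEnvelopingAlgebra.lift_ι_apply]
    exact (hpow x).symm⟩

theorem uLift_uemb (hpow : ∀ x, f (pmap p F L x) = f x ^ p) (x : L) :
    uLift f hlie hpow (uemb p F L x) = f x :=
  (RingQuot.liftAlgHom_mkAlgHom_apply ..).trans (UniversalEnvelopingAlgebra.lift_ι_apply F _ x)

end Lift

section Ideals

theorem top_mul_top_submodule {A : Type*} [Semiring A] [Algebra F A] :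
    (⊤ : Submodule F A) * ⊤ = ⊤ :=
  eq_top_iff.mpr fun a _ => by
    simpa using Submodule.mul_mem_mul (Submodule.mem_top (x := a)) (Submodule.mem_top (x := 1))

/-- The image of `L'` in `u(L)`. -/
abbrev uDerived : Submodule F (uEnv p F L) := (derivedSub F L).map (uemb p F L)

theorem uemb_lie_mem_uDerived (x y : L) : uemb p F L ⁅x, y⁆ ∈ uDerived p F L := by
  refine Submodule.mem_map_of_mem ?_
  rw [derivedSub_eq_span]
  exact Submodule.subset_span ⟨x, y, rfl⟩

theorem uDerived_mul_top_le : uDerived p F L * ⊤ ≤ ⊤ * uDerived p F L := by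
  have key : ∀ a : uEnv p F L, ∀ d ∈ uDerived p F L, d * a ∈ ⊤ * uDerived p F L := by
    have hD : uDerived p F L ≤ ⊤ * uDerived p F L := fun d hd => by
      simpa using Submodule.mul_mem_mul (Submodule.mem_top (x := 1)) hd
    intro a
    induction a using uEnv_induction with
    | emb x =>
      rintro _ ⟨y, hy, rfl⟩
      rw [← sub_add_cancel (uemb p F L y * uemb p F L x) (uemb p F L x * uemb p F L y), ← uemb_lie]
      exact Submodule.add_mem _ (hD (uemb_lie_mem_uDerived p F L y x))
        (Submodule.mul_mem_mul Submodule.mem_top ⟨y, hy, rfl⟩)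
    | scalar c =>
      intro d hd
      rw [← Algebra.commutes, ← Algebra.smul_def]
      exact Submodule.smul_mem _ _ (hD hd)
    | add a b ha hb =>
      intro d hd
      rw [mul_add]
      exact Submodule.add_mem _ (ha d hd) (hb d hd)
    | mul a b ha hb =>
      intro d hd
      rw [← mul_assoc]
      have hle : ⊤ * uDerived p F L ≤ Submodule.comap (LinearMap.mulRight F b)
          (⊤ * uDerived p F L) := Submodule.mul_le.mpr fun c _ d hd => by
        rw [Submodule.mem_comap, LinearMap.mulRight_apply, mul_assoc]
        have := Submodule.mul_mem_mul (Submodule.mem_top (x := c)) (hb d hd)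
        rwa [← mul_assoc, top_mul_top_submodule] at this
      exact hle (ha d hd)
  exact Submodule.mul_le.mpr fun d hd a _ => key a d hd

variable [Fact p.Prime]

theorem aug_uemb (x : L) : aug p F L (uemb p F L x) = 0 :=
  (RingQuot.liftAlgHom_mkAlgHom_apply ..).trans (UniversalEnvelopingAlgebra.lift_ι_apply F _ x)

variable {p F L} in
theorem mem_omegaIdeal {a : uEnv p F L} : a ∈ omegaIdeal p F L ↔ aug p F L a = 0 :=
  Iff.rfl

theorem lSub_le_omegaIdeal : lSub p F L ≤ omegaIdeal p F L := by
  rintro _ ⟨x, rfl⟩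
  exact aug_uemb p F L x

theorem sub_aug_mem_omegaIdeal (a : uEnv p F L) :
    a - algebraMap F _ (aug p F L a) ∈ omegaIdeal p F L := by
  simp [mem_omegaIdeal]

theorem omegaIdeal_mul_top : omegaIdeal p F L * ⊤ = omegaIdeal p F L := by
  refine le_antisymm (Submodule.mul_le.mpr fun b hb a _ => ?_)
    fun b hb => by simpa using Submodule.mul_mem_mul hb (Submodule.mem_top (x := 1))
  rw [mem_omegaIdeal] at hb ⊢
  rw [map_mul, hb, zero_mul]

theorem top_eq_one_sup_omegaIdeal : (⊤ : Submodule F (uEnv p F L)) = 1 ⊔ omegaIdeal p F L := by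
  refine (eq_top_iff.mpr fun a _ => ?_).symm
  rw [← add_sub_cancel (algebraMap F _ (aug p F L a)) a]
  exact Submodule.add_mem_sup (Submodule.mem_one.mpr ⟨_, rfl⟩) (sub_aug_mem_omegaIdeal p F L a)

/-- The augmentation ideal is generated by `L` modulo its square. -/
theorem omegaIdeal_le_lSub_sup_sq :
    omegaIdeal p F L ≤ lSub p F L ⊔ omegaIdeal p F L * omegaIdeal p F L := by
  have key : ∀ a : uEnv p F L, a - algebraMap F _ (aug p F L a) ∈
      lSub p F L ⊔ omegaIdeal p F L * omegaIdeal p F L := by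
    intro a
    induction a using uEnv_induction with
    | emb x =>
      rw [aug_uemb, map_zero, sub_zero]
      exact Submodule.mem_sup_left ⟨x, rfl⟩
    | scalar c => simp
    | add a b ha hb =>
      rw [map_add, map_add, add_sub_add_comm]
      exact Submodule.add_mem _ ha hb
    | mul a b ha hb =>
      have h : a * b - algebraMap F _ (aug p F L (a * b)) =
          (a - algebraMap F _ (aug p F L a)) * (b - algebraMap F _ (aug p F L b)) +
          (aug p F L a • (b - algebraMap F _ (aug p F L b)) +
            aug p F L b • (a - algebraMap F _ (aug p F L a))) := by
        simp only [Algebra.smul_def, map_mul, mul_sub, sub_mul,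
          Algebra.commutes (aug p F L b)]
        abel
      rw [h]
      exact Submodule.add_mem _ (Submodule.mem_sup_right (Submodule.mul_mem_mul
        (sub_aug_mem_omegaIdeal p F L a) (sub_aug_mem_omegaIdeal p F L b)))
        (Submodule.add_mem _ (Submodule.smul_mem _ _ hb) (Submodule.smul_mem _ _ ha))
  intro a ha
  simpa [mem_omegaIdeal.mp ha] using key a

end Ideals

end Enveloping

section CommutatorIdeal

/-- The two-sided ideal generated by all commutators, as a subspace. -/
def commutatorIdeal (F A : Type*) [Field F] [Ring A] [Algebra F A] : Submodule F A :=
  ⊤ * Submodule.span F {c | ∃ a b : A, a * b - b * a = c} * ⊤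

theorem map_commutatorIdeal {F A B : Type*} [Field F] [Ring A] [Algebra F A] [Ring B] [Algebra F B]
    (φ : A ≃ₐ[F] B) :
    (commutatorIdeal F A).map φ.toLinearMap = commutatorIdeal F B := by
  change (commutatorIdeal F A).map (φ : A →ₐ[F] B).toLinearMap = commutatorIdeal F B
  have htop : (⊤ : Submodule F A).map (φ : A →ₐ[F] B).toLinearMap = ⊤ := by
    rw [Submodule.map_top, LinearMap.range_eq_top]
    exact φ.surjective
  rw [commutatorIdeal, Submodule.map_mul, Submodule.map_mul, htop, Submodule.map_span,
    commutatorIdeal]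
  congr 3
  ext c
  constructor
  · rintro ⟨_, ⟨a, b, rfl⟩, rfl⟩
    exact ⟨φ a, φ b, by simp⟩
  · rintro ⟨a, b, rfl⟩
    exact ⟨_, ⟨φ.symm a, φ.symm b, rfl⟩, by simp⟩

theorem commutator_mem_commutatorIdeal (F : Type*) {A : Type*} [Field F] [Ring A] [Algebra F A]
    (a b : A) : a * b - b * a ∈ commutatorIdeal F A := by
  have hc : a * b - b * a ∈ Submodule.span F {c | ∃ a b : A, a * b - b * a = c} :=
    Submodule.subset_span ⟨a, b, rfl⟩
  have h := Submodule.mul_mem_mul (Submodule.mul_mem_mul (Submodule.mem_top (R := F) (x := (1 : A)))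
    hc) (Submodule.mem_top (R := F) (x := (1 : A)))
  rwa [one_mul, mul_one] at h

theorem mul_mem_commutatorIdeal {F A : Type*} [Field F] [Ring A] [Algebra F A]
    (a : A) {c : A} (hc : c ∈ commutatorIdeal F A) : a * c ∈ commutatorIdeal F A := by
  have h := Submodule.mul_mem_mul (Submodule.mem_top (R := F) (x := a)) hc
  rwa [commutatorIdeal, ← mul_assoc, ← mul_assoc, top_mul_top_submodule] at h

theorem commutatorIdeal_mul_mem {F A : Type*} [Field F] [Ring A] [Algebra F A]
    {c : A} (hc : c ∈ commutatorIdeal F A) (a : A) : c * a ∈ commutatorIdeal F A := by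
  have h := Submodule.mul_mem_mul hc (Submodule.mem_top (R := F) (x := a))
  rwa [commutatorIdeal, mul_assoc, top_mul_top_submodule] at h

/-- The commutator ideal as an ideal. -/
def commutatorTwoSided (F A : Type*) [Field F] [Ring A] [Algebra F A] : Ideal A :=
  { (commutatorIdeal F A).toAddSubmonoid with
    smul_mem' := fun a _ hc => mul_mem_commutatorIdeal a hc }

theorem mem_commutatorTwoSided {F A : Type*} [Field F] [Ring A] [Algebra F A] {a : A} :
    a ∈ commutatorTwoSided F A ↔ a ∈ commutatorIdeal F A :=
  Iff.rfl

instance (F A : Type*) [Field F] [Ring A] [Algebra F A] : (commutatorTwoSided F A).IsTwoSided :=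
  ⟨fun b hc => mem_commutatorTwoSided.mpr
    (commutatorIdeal_mul_mem (F := F) (mem_commutatorTwoSided.mp hc) b)⟩

/-- The quotient map modulo the commutator ideal, with values in a commutative algebra. -/
def toCommQuotient (F A : Type*) [Field F] [Ring A] [Algebra F A] :
    A →ₐ[F] Subalgebra.center F (A ⧸ commutatorTwoSided F A) :=
  (Ideal.Quotient.mkₐ F (commutatorTwoSided F A)).codRestrict _ fun a => by
    rw [Subalgebra.mem_center_iff]
    intro b
    obtain ⟨b, rfl⟩ := Ideal.Quotient.mkₐ_surjective F (commutatorTwoSided F A) b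
    rw [← map_mul, ← map_mul]
    exact Ideal.Quotient.eq.mpr (commutator_mem_commutatorIdeal F b a)

theorem mem_commutatorIdeal_of_toCommQuotient_eq_zero {F A : Type*} [Field F] [Ring A]
    [Algebra F A] {a : A} (ha : toCommQuotient F A a = 0) : a ∈ commutatorIdeal F A :=
  mem_commutatorTwoSided.mp (Ideal.Quotient.eq_zero_iff_mem.mp (congrArg Subtype.val ha))

/-- Homomorphisms to commutative algebras vanish on commutators. -/
theorem commutatorIdeal_le_ker {F A C : Type*} [Field F] [Ring A] [Algebra F A] [CommRing C]
    [Algebra F C] (χ : A →ₐ[F] C) : commutatorIdeal F A ≤ LinearMap.ker χ.toLinearMap := by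
  have hspan : Submodule.span F {c | ∃ a b : A, a * b - b * a = c} ≤
      LinearMap.ker χ.toLinearMap := by
    refine Submodule.span_le.mpr ?_
    rintro _ ⟨a, b, rfl⟩
    simp [mul_comm]
  refine Submodule.mul_le.mpr fun x hx c _ => ?_
  have hx' : χ x = 0 := by
    refine (Submodule.mul_le (P := LinearMap.ker χ.toLinearMap)).mpr (fun a _ b hb => ?_) hx
    have hb' : χ b = 0 := hspan hb
    simp [hb']
  simp [hx']

variable (p : ℕ) (F : Type*) [Field F]
variable (L : Type*) [LieRing L] [LieAlgebra F L] [RestrictedLieAlgebra p F L]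

theorem commutatorIdeal_uEnv : commutatorIdeal F (uEnv p F L) = ⊤ * uDerived p F L := by
  have hD : uDerived p F L ≤ ⊤ * uDerived p F L := fun d hd => by
    simpa using Submodule.mul_mem_mul (Submodule.mem_top (x := 1)) hd
  have hl : ∀ (a : uEnv p F L), ∀ c ∈ ⊤ * uDerived p F L, a * c ∈ ⊤ * uDerived p F L := by
    intro a c hc
    have h := Submodule.mul_mem_mul (Submodule.mem_top (R := F) (x := a)) hc
    rwa [← mul_assoc, top_mul_top_submodule] at h
  have hr' : ⊤ * uDerived p F L * ⊤ ≤ ⊤ * uDerived p F L := by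
    rw [mul_assoc]
    refine (mul_le_mul_right (uDerived_mul_top_le p F L) ⊤).trans ?_
    rw [← mul_assoc, top_mul_top_submodule]
  have hr : ∀ (a : uEnv p F L), ∀ c ∈ ⊤ * uDerived p F L, c * a ∈ ⊤ * uDerived p F L :=
    fun a c hc => hr' (Submodule.mul_mem_mul hc Submodule.mem_top)
  have hcomm_step : ∀ c : uEnv p F L,
      (∀ x, c * uemb p F L x - uemb p F L x * c ∈ ⊤ * uDerived p F L) →
      ∀ a, c * a - a * c ∈ ⊤ * uDerived p F L := by
    intro c hc a
    induction a using uEnv_induction with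
    | emb x => exact hc x
    | scalar r => simp [Algebra.commutes]
    | add a b ha hb =>
      rw [mul_add, add_mul, add_sub_add_comm]
      exact Submodule.add_mem _ ha hb
    | mul a b ha hb =>
      have h : c * (a * b) - a * b * c = (c * a - a * c) * b + a * (c * b - b * c) := by
        noncomm_ring
      rw [h]
      exact Submodule.add_mem _ (hr _ _ ha) (hl _ _ hb)
  have hcomm : ∀ a b : uEnv p F L, a * b - b * a ∈ ⊤ * uDerived p F L := by
    refine fun a => hcomm_step a fun x => ?_
    rw [← neg_sub]
    refine Submodule.neg_mem _ (hcomm_step _ (fun y => ?_) a)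
    rw [← uemb_lie]
    exact hD (uemb_lie_mem_uDerived p F L x y)
  refine le_antisymm (Submodule.mul_le.mpr fun c hc a _ => hr a c ?_)
    (Submodule.mul_le.mpr fun a _ d hd => mul_mem_commutatorIdeal a ?_)
  · have hspan : Submodule.span F {c | ∃ a b : uEnv p F L, a * b - b * a = c} ≤
        ⊤ * uDerived p F L := by
      refine Submodule.span_le.mpr ?_
      rintro _ ⟨a, b, rfl⟩
      exact hcomm a b
    exact (Submodule.mul_le.mpr fun a _ b hb => hl a b (hspan hb)) hc
  · have hle : uDerived p F L ≤ commutatorIdeal F (uEnv p F L) := by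
      rw [uDerived, derivedSub_eq_span, Submodule.map_span, Submodule.span_le]
      rintro _ ⟨_, ⟨x, y, rfl⟩, rfl⟩
      rw [uemb_lie]
      exact commutator_mem_commutatorIdeal F _ _
    exact hle hd

variable [Fact p.Prime]

theorem top_mul_uDerived :
    ⊤ * uDerived p F L = uDerived p F L ⊔ omegaIdeal p F L * uDerived p F L := by
  rw [top_eq_one_sup_omegaIdeal, Submodule.sup_mul, one_mul]

/-- `J_L` expressed through the augmentation ideal and the commutator ideal only. -/
theorem jIdeal_eq : jIdeal p F L = omegaIdeal p F L * commutatorIdeal F (uEnv p F L) ⊔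
    commutatorIdeal F (uEnv p F L) * omegaIdeal p F L := by
  have h₁ : omegaIdeal p F L * commutatorIdeal F (uEnv p F L) =
      omegaIdeal p F L * uDerived p F L := by
    rw [commutatorIdeal_uEnv, ← mul_assoc, omegaIdeal_mul_top]
  rw [h₁, commutatorIdeal_uEnv, top_mul_uDerived, Submodule.sup_mul, jIdeal, Submodule.add_eq_sup]
  refine le_antisymm (sup_le_sup le_rfl le_sup_left)
    (sup_le le_sup_left (sup_le le_sup_right (le_sup_of_le_left ?_)))
  calc omegaIdeal p F L * uDerived p F L * omegaIdeal p F L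
      ≤ omegaIdeal p F L * (⊤ * uDerived p F L) := by
        rw [mul_assoc]
        exact mul_le_mul_right
          ((mul_le_mul_right le_top _).trans (uDerived_mul_top_le p F L)) _
    _ = omegaIdeal p F L * uDerived p F L := by rw [← mul_assoc, omegaIdeal_mul_top]

theorem jIdeal_le_commutatorIdeal : jIdeal p F L ≤ commutatorIdeal F (uEnv p F L) := by
  rw [jIdeal_eq]
  exact sup_le (Submodule.mul_le.mpr fun a _ _ hc => mul_mem_commutatorIdeal a hc)
    (Submodule.mul_le.mpr fun _ hc a _ => commutatorIdeal_mul_mem hc a)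

theorem jIdeal_le_omegaIdeal : jIdeal p F L ≤ omegaIdeal p F L :=
  (jIdeal_le_commutatorIdeal p F L).trans (commutatorIdeal_le_ker (aug p F L))

theorem commutatorIdeal_le_lSub_sup_jIdeal :
    commutatorIdeal F (uEnv p F L) ≤ lSub p F L ⊔ jIdeal p F L := by
  rw [commutatorIdeal_uEnv, top_mul_uDerived]
  exact sup_le_sup LinearMap.map_le_range le_sup_left

variable {p F L} in
/-- An isomorphism preserving augmentation ideals maps `J_L` onto `J_H`. -/
theorem map_jIdeal {H : Type*} [LieRing H] [LieAlgebra F H] [RestrictedLieAlgebra p F H]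
    (φ : uEnv p F L ≃ₐ[F] uEnv p F H)
    (hω : (omegaIdeal p F L).map φ.toLinearMap = omegaIdeal p F H) :
    (jIdeal p F L).map φ.toLinearMap = jIdeal p F H := by
  have hmul : ∀ M N : Submodule F (uEnv p F L), (M * N).map φ.toLinearMap =
      M.map φ.toLinearMap * N.map φ.toLinearMap := fun M N =>
    Submodule.map_mul M N (φ : uEnv p F L →ₐ[F] uEnv p F H)
  rw [jIdeal_eq, jIdeal_eq, Submodule.map_sup, hmul, hmul, hω, map_commutatorIdeal]

end CommutatorIdeal

end RestrictedLieAlgebra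

namespace RestrictedLieAlgebra

section TruncatedPolynomials

open MvPolynomial

variable (p : ℕ) (F : Type*) [Field F] {σ : Type*} (N : σ → ℕ)

/-- The ideal of `F[X_i]` generated by the powers `X_i ^ (p ^ N i)`. -/
noncomputable def truncIdeal : Ideal (MvPolynomial σ F) :=
  Ideal.span ((fun s => monomial s (1 : F)) '' Set.range fun i => Finsupp.single i (p ^ N i))

/-- The truncated polynomial algebra `F[X_i] / (X_i ^ (p ^ N i))`. -/
abbrev TruncPoly := MvPolynomial σ F ⧸ truncIdeal p F N

/-- The quotient map from polynomials to truncated polynomials. -/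
noncomputable abbrev TruncPoly.mk : MvPolynomial σ F →ₐ[F] TruncPoly p F N :=
  Ideal.Quotient.mkₐ F (truncIdeal p F N)

variable {p F N} in
theorem mem_truncIdeal {f : MvPolynomial σ F} :
    f ∈ truncIdeal p F N ↔ ∀ s ∈ f.support, ∃ i, p ^ N i ≤ s i := by
  simp [truncIdeal, mem_ideal_span_monomial_image]

theorem TruncPoly.mk_eq_zero {f : MvPolynomial σ F} :
    TruncPoly.mk p F N f = 0 ↔ ∀ s ∈ f.support, ∃ i, p ^ N i ≤ s i :=
  Ideal.Quotient.eq_zero_iff_mem.trans mem_truncIdeal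

theorem TruncPoly.mk_surjective : Function.Surjective (TruncPoly.mk p F N) :=
  Ideal.Quotient.mkₐ_surjective _ _

theorem TruncPoly.mk_monomial_eq_zero {s : σ →₀ ℕ} {i : σ} (h : p ^ N i ≤ s i) (c : F) :
    TruncPoly.mk p F N (monomial s c) = 0 := by
  rw [TruncPoly.mk_eq_zero]
  intro t ht
  obtain rfl : t = s := by simpa using support_monomial_subset ht
  exact ⟨i, h⟩

theorem TruncPoly.mk_X_pow_eq_zero {i : σ} {k : ℕ} (h : p ^ N i ≤ k) :
    TruncPoly.mk p F N (X i) ^ k = 0 := by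
  rw [← map_pow, X_pow_eq_monomial]
  exact TruncPoly.mk_monomial_eq_zero p F N (i := i) (by simpa using h) 1

/-- Truncated monomials are linearly independent. -/
theorem TruncPoly.linearIndependent_monomial :
    LinearIndependent F
      (fun s : {s : σ →₀ ℕ // ∀ i, s i < p ^ N i} => TruncPoly.mk p F N (monomial s.1 1)) := by
  classical
  rw [linearIndependent_iff']
  intro S g hg s hs
  have h0 : TruncPoly.mk p F N (∑ t ∈ S, g t • monomial t.1 1) = 0 := by
    simpa only [map_sum, map_smul] using hg
  rw [TruncPoly.mk_eq_zero] at h0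
  by_contra hne
  have hc : coeff s.1 (∑ t ∈ S, g t • monomial t.1 (1 : F)) = g s := by
    simp only [coeff_sum, coeff_smul, coeff_monomial, smul_eq_mul, mul_ite, mul_one, mul_zero]
    rw [Finset.sum_eq_single s]
    · simp
    · intro b _ hb
      rw [if_neg (fun h => hb (Subtype.ext h))]
    · exact fun h => absurd hs h
  obtain ⟨i, hi⟩ := h0 s.1 (by rw [mem_support_iff, hc]; exact hne)
  exact absurd (s.2 i) (not_lt.mpr hi)

instance TruncPoly.finite [Finite σ] : Module.Finite F (TruncPoly p F N) := by
  have hfin : Finite {s : σ →₀ ℕ // ∀ i, s i < p ^ N i} :=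
    Finite.of_injective (β := ∀ i, Fin (p ^ N i)) (fun s i => ⟨s.1 i, s.2 i⟩) fun s t h =>
      Subtype.ext (Finsupp.ext fun i => congrArg Fin.val (congrFun h i))
  refine ⟨Submodule.fg_def.mpr ⟨_, Set.finite_range
    (fun s : {s : σ →₀ ℕ // ∀ i, s i < p ^ N i} => TruncPoly.mk p F N (monomial s.1 1)), ?_⟩⟩
  rw [eq_top_iff]
  rintro x -
  obtain ⟨f, rfl⟩ := TruncPoly.mk_surjective p F N x
  induction f using MvPolynomial.induction_on' with
  | monomial s c =>
    by_cases hs : ∀ i, s i < p ^ N i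
    · rw [← mul_one c, ← smul_eq_mul, ← smul_monomial, map_smul]
      exact Submodule.smul_mem _ _ (Submodule.subset_span ⟨⟨s, hs⟩, rfl⟩)
    · push Not at hs
      obtain ⟨i, hi⟩ := hs
      rw [TruncPoly.mk_monomial_eq_zero p F N hi]
      exact Submodule.zero_mem _
  | add f g hf hg =>
    rw [map_add]
    exact Submodule.add_mem _ hf hg

/-- An algebra homomorphism out of the truncated polynomial algebra, from the images of the
variables. -/
noncomputable def TruncPoly.lift {C : Type*} [CommRing C] [Algebra F C] (c : σ → C)
    (hc : ∀ i, c i ^ p ^ N i = 0) : TruncPoly p F N →ₐ[F] C :=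
  Ideal.Quotient.liftₐ _ (aeval c) fun f hf => by
    have hle : truncIdeal p F N ≤ RingHom.ker (aeval c : MvPolynomial σ F →ₐ[F] C) := by
      refine Ideal.span_le.mpr ?_
      rintro _ ⟨_, ⟨i, rfl⟩, rfl⟩
      simp [RingHom.mem_ker, aeval_monomial, hc]
    exact hle hf

@[simp]
theorem TruncPoly.lift_mk {C : Type*} [CommRing C] [Algebra F C] (c : σ → C)
    (hc : ∀ i, c i ^ p ^ N i = 0) (f : MvPolynomial σ F) :
    TruncPoly.lift p F N c hc (TruncPoly.mk p F N f) = aeval c f :=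
  rfl

/-- The exponents of the monomials `X_i ^ (p ^ j)`. -/
def IsPPowExponent (s : σ →₀ ℕ) : Prop := ∃ i j, s = Finsupp.single i (p ^ j)

open Classical in
/-- The projection of polynomials onto the span of the `X_i ^ (p ^ j)` which kills all
other monomials. -/
noncomputable def pPowProjAux : MvPolynomial σ F →ₗ[F] MvPolynomial σ F :=
  (basisMonomials σ F).constr F fun s => if IsPPowExponent p s then monomial s 1 else 0

open Classical in
theorem pPowProjAux_monomial (s : σ →₀ ℕ) (c : F) :
    pPowProjAux p F (monomial s c) = if IsPPowExponent p s then monomial s c else 0 := by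
  have h := (basisMonomials σ F).constr_basis F
    (fun s => if IsPPowExponent p s then monomial s (1 : F) else 0) s
  rw [coe_basisMonomials] at h
  rw [← mul_one c, ← smul_eq_mul, ← smul_monomial, map_smul, pPowProjAux, h, smul_ite, smul_zero]

theorem pPowProjAux_mem {f : MvPolynomial σ F} (hf : f ∈ truncIdeal p F N) :
    pPowProjAux p F f ∈ truncIdeal p F N := by
  rw [as_sum f, map_sum]
  refine Ideal.sum_mem _ fun s hs => ?_
  rw [pPowProjAux_monomial]
  split_ifs
  · obtain ⟨i, hi⟩ := mem_truncIdeal.mp hf s hs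
    exact Ideal.Quotient.eq_zero_iff_mem.mp (TruncPoly.mk_monomial_eq_zero p F N hi _)
  · exact Ideal.zero_mem _

/-- The projection of truncated polynomials onto the span of the `X_i ^ (p ^ j)` which kills
all other monomials. -/
noncomputable def pPowProj : TruncPoly p F N →ₗ[F] TruncPoly p F N :=
  (((truncIdeal p F N).restrictScalars F).liftQ
      ((TruncPoly.mk p F N).toLinearMap ∘ₗ pPowProjAux p F) fun _ hf =>
        Ideal.Quotient.eq_zero_iff_mem.mpr (pPowProjAux_mem p F N hf)) ∘ₗ
    (Submodule.Quotient.restrictScalarsEquiv F (truncIdeal p F N)).symm.toLinearMap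

theorem pPowProj_mk (f : MvPolynomial σ F) :
    pPowProj p F N (TruncPoly.mk p F N f) = TruncPoly.mk p F N (pPowProjAux p F f) :=
  rfl

theorem pPowProj_X (i : σ) :
    pPowProj p F N (TruncPoly.mk p F N (X i)) = TruncPoly.mk p F N (X i) := by
  rw [pPowProj_mk, X, pPowProjAux_monomial, if_pos ⟨i, 0, by simp⟩]

variable {N} in
theorem pPowProj_mk_mem {C : Submodule F (TruncPoly p F N)} {f : MvPolynomial σ F}
    (hC : ∀ i j, coeff (Finsupp.single i (p ^ j)) f ≠ 0 → TruncPoly.mk p F N (X i) ^ p ^ j ∈ C) :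
    pPowProj p F N (TruncPoly.mk p F N f) ∈ C := by
  rw [pPowProj_mk, ← support_sum_monomial_coeff f, map_sum, map_sum]
  refine Submodule.sum_mem _ fun s hs => ?_
  rw [pPowProjAux_monomial]
  split_ifs with h
  · obtain ⟨i, j, rfl⟩ := h
    rw [← mul_one (coeff _ f), ← smul_eq_mul, ← smul_monomial, map_smul, ← X_pow_eq_monomial,
      map_pow]
    exact Submodule.smul_mem _ _ (hC i j (mem_support_iff.mp hs))
  · rw [map_zero]
    exact Submodule.zero_mem _

variable [hp : Fact p.Prime]

variable {p F N} in
theorem TruncPoly.add_pow_prime_pow [CharP F p] (a b : TruncPoly p F N) (j : ℕ) :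
    (a + b) ^ p ^ j = a ^ p ^ j + b ^ p ^ j := by
  cases subsingleton_or_nontrivial (TruncPoly p F N)
  · exact Subsingleton.elim _ _
  · have := charP_of_injective_algebraMap (algebraMap F (TruncPoly p F N)).injective p
    exact add_pow_char_pow a b p j

theorem IsPPowExponent.ne_zero {s : σ →₀ ℕ} (h : IsPPowExponent p s) : s ≠ 0 := by
  obtain ⟨i, j, rfl⟩ := h
  simp [hp.out.ne_zero]

theorem isPPowExponent_nsmul {s : σ →₀ ℕ} : IsPPowExponent p (p • s) ↔ IsPPowExponent p s := by
  constructor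
  · rintro ⟨i, j, h⟩
    have hi := DFunLike.congr_fun h i
    simp only [Finsupp.smul_apply, smul_eq_mul, Finsupp.single_eq_same] at hi
    cases j with
    | zero => exact absurd (Nat.eq_one_of_mul_eq_one_right (by simpa using hi)) hp.out.one_lt.ne'
    | succ j =>
      refine ⟨i, j, ?_⟩
      have h' : p • s = p • Finsupp.single i (p ^ j) := by
        rw [h, Finsupp.smul_single, smul_eq_mul, pow_succ']
      ext k
      have := DFunLike.congr_fun h' k
      exact Nat.eq_of_mul_eq_mul_left hp.out.pos this
  · rintro ⟨i, j, rfl⟩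
    exact ⟨i, j + 1, by rw [Finsupp.smul_single, smul_eq_mul, pow_succ']⟩

theorem pPowProj_pow [CharP F p] (t : TruncPoly p F N) :
    pPowProj p F N (t ^ p) = pPowProj p F N t ^ p := by
  obtain ⟨f, rfl⟩ := TruncPoly.mk_surjective p F N t
  rw [← map_pow, pPowProj_mk, pPowProj_mk, ← map_pow]
  congr 1
  induction f using MvPolynomial.induction_on' with
  | monomial s c =>
    rw [monomial_pow, pPowProjAux_monomial, pPowProjAux_monomial]
    by_cases h : IsPPowExponent p s
    · rw [if_pos h, if_pos ((isPPowExponent_nsmul p).mpr h), monomial_pow]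
    · rw [if_neg h, if_neg (mt (isPPowExponent_nsmul p).mp h), zero_pow hp.out.ne_zero]
  | add f g hf hg => rw [add_pow_char, map_add, map_add, add_pow_char, hf, hg]

/-- The augmentation of the truncated polynomial algebra. -/
noncomputable def TruncPoly.aug : TruncPoly p F N →ₐ[F] F :=
  TruncPoly.lift p F N 0 fun _ => zero_pow (pow_ne_zero _ hp.out.ne_zero)

theorem TruncPoly.aug_mk (f : MvPolynomial σ F) :
    TruncPoly.aug p F N (TruncPoly.mk p F N f) = constantCoeff f := by
  rw [TruncPoly.aug, TruncPoly.lift_mk, aeval_zero, Algebra.algebraMap_self, RingHom.id_apply]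

variable {N} in
theorem pPowProj_mul_mem {t t' : TruncPoly p F N} (ht : TruncPoly.aug p F N t = 0)
    (ht' : TruncPoly.aug p F N t' = 0) :
    pPowProj p F N (t * t') ∈
      Submodule.span F {u | ∃ i j, 1 ≤ j ∧ u = TruncPoly.mk p F N (X i) ^ p ^ j} := by
  obtain ⟨f, rfl⟩ := TruncPoly.mk_surjective p F N t
  obtain ⟨g, rfl⟩ := TruncPoly.mk_surjective p F N t'
  rw [TruncPoly.aug_mk, constantCoeff_eq] at ht ht'
  rw [← map_mul]
  refine pPowProj_mk_mem p F fun i j hij => Submodule.subset_span ⟨i, j, ?_, rfl⟩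
  by_contra hj
  obtain rfl : j = 0 := by lia
  refine hij ?_
  classical
  rw [coeff_mul]
  refine Finset.sum_eq_zero fun x hx => ?_
  have hdeg := congrArg Finsupp.degree (Finset.HasAntidiagonal.mem_antidiagonal.mp hx)
  rw [map_add, Finsupp.degree_single, pow_zero] at hdeg
  rcases Nat.eq_zero_or_pos x.1.degree with h | h
  · rw [(Finsupp.degree_eq_zero_iff _).mp h, ht, zero_mul]
  · rw [(Finsupp.degree_eq_zero_iff x.2).mp (by lia), ht', mul_zero]

end TruncatedPolynomials

end RestrictedLieAlgebra

namespace RestrictedLieAlgebra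

section Digits

variable {n : ℕ} {ex : Fin n → ℕ} (p : ℕ)

/-- The exponents of the monomial in the generators with base-`p` digits `a i j`. -/
noncomputable def digitExponent (a : (i : Fin n) → Fin (ex i) → ℕ) : Fin n →₀ ℕ :=
  Finsupp.equivFunOnFinite.symm fun i => ∑ j, a i j * p ^ (j : ℕ)

theorem digitExponent_apply (a : (i : Fin n) → Fin (ex i) → ℕ) (i : Fin n) :
    digitExponent p a i = ∑ j, a i j * p ^ (j : ℕ) :=
  rfl

variable {p}

theorem digitExponent_apply_eq {a : (i : Fin n) → Fin (ex i) → ℕ} (ha : ∀ i j, a i j < p)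
    (i : Fin n) : digitExponent p a i = finFunctionFinEquiv fun j => (⟨a i j, ha i j⟩ : Fin p) := by
  rw [finFunctionFinEquiv_apply, digitExponent_apply]

theorem digitExponent_lt {a : (i : Fin n) → Fin (ex i) → ℕ} (ha : ∀ i j, a i j < p) (i : Fin n) :
    digitExponent p a i < p ^ ex i := by
  rw [digitExponent_apply_eq ha]
  exact Fin.is_lt _

theorem digitExponent_injective {a b : (i : Fin n) → Fin (ex i) → ℕ} (ha : ∀ i j, a i j < p)
    (hb : ∀ i j, b i j < p) (h : digitExponent p a = digitExponent p b) : a = b := by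
  funext i j
  have hi := DFunLike.congr_fun h i
  rw [digitExponent_apply_eq ha, digitExponent_apply_eq hb] at hi
  exact congrArg Fin.val (congrFun (finFunctionFinEquiv.injective (Fin.ext hi)) j)

theorem exists_digitExponent_eq {s : Fin n →₀ ℕ} (hs : ∀ i, s i < p ^ ex i) :
    ∃ a : (i : Fin n) → Fin (ex i) → ℕ, (∀ i j, a i j < p) ∧ digitExponent p a = s := by
  refine ⟨fun i j => finFunctionFinEquiv.symm ⟨s i, hs i⟩ j, fun i j => Fin.is_lt _, ?_⟩
  ext i
  rw [digitExponent_apply_eq fun i j => Fin.is_lt _]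
  exact congrArg Fin.val (finFunctionFinEquiv.apply_symm_apply ⟨s i, hs i⟩)

theorem digitExponent_single (q : Σ i, Fin (ex i)) :
    digitExponent p (fun i j => Finsupp.single q 1 ⟨i, j⟩) =
      Finsupp.single q.1 (p ^ (q.2 : ℕ)) := by
  obtain ⟨i, j⟩ := q
  ext k
  rw [digitExponent_apply]
  by_cases hk : i = k
  · subst hk
    rw [Finsupp.single_eq_same, Finset.sum_eq_single j]
    · simp
    · intro j' _ hj'
      rw [Finsupp.single_eq_of_ne (by simpa using hj'), zero_mul]
    · simp
  · rw [Finsupp.single_eq_of_ne (Ne.symm hk)]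
    refine Finset.sum_eq_zero fun j' _ => ?_
    rw [Finsupp.single_eq_of_ne (by rintro ⟨⟩; exact hk rfl), zero_mul]

theorem degree_equivFunOnFinite_symm_sigma (a : (i : Fin n) → Fin (ex i) → ℕ) :
    (Finsupp.equivFunOnFinite.symm fun q : Σ i, Fin (ex i) => a q.1 q.2).degree =
      ∑ i, ∑ j, a i j := by
  rw [Finsupp.degree_eq_sum, Fintype.sum_sigma]
  rfl

theorem not_isPPowExponent_digitExponent [hp : Fact p.Prime] {a : (i : Fin n) → Fin (ex i) → ℕ}
    (ha : ∀ i j, a i j < p) (h2 : 2 ≤ ∑ i, ∑ j, a i j) :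
    ¬ IsPPowExponent p (digitExponent p a) := by
  rintro ⟨i, j, hij⟩
  have hj : p ^ j < p ^ ex i := by simpa [hij] using digitExponent_lt ha i
  let q : Σ i, Fin (ex i) := ⟨i, j, (Nat.pow_lt_pow_iff_right hp.out.one_lt).mp hj⟩
  have h : a = fun i j => Finsupp.single q 1 ⟨i, j⟩ := by
    refine digitExponent_injective ha (fun i j => ?_) (hij.trans (digitExponent_single q).symm)
    classical
    rw [Finsupp.single_apply]
    split_ifs
    exacts [hp.out.one_lt, hp.out.pos]
  have hdeg : ∑ i, ∑ j, a i j = 1 := by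
    rw [← degree_equivFunOnFinite_symm_sigma, h]
    refine Eq.trans (congrArg Finsupp.degree (Finsupp.ext fun _ => ?_)) (Finsupp.degree_single q 1)
    rfl
  lia

theorem two_le_sum_of_not_isPPowExponent {a : (i : Fin n) → Fin (ex i) → ℕ}
    (h0 : digitExponent p a ≠ 0) (hP : ¬ IsPPowExponent p (digitExponent p a)) :
    2 ≤ ∑ i, ∑ j, a i j := by
  by_contra! hlt
  set c := Finsupp.equivFunOnFinite.symm fun q : Σ i, Fin (ex i) => a q.1 q.2 with hc
  have hac : a = fun i j => c ⟨i, j⟩ := rfl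
  rw [← degree_equivFunOnFinite_symm_sigma, ← hc] at hlt
  by_cases hc0 : c = 0
  · refine h0 ?_
    ext i
    rw [digitExponent_apply, hac, hc0]
    simp
  · obtain ⟨q, hq⟩ := Finsupp.ne_iff.mp hc0
    rw [Finsupp.coe_zero, Pi.zero_apply] at hq
    have hle : Finsupp.single q 1 ≤ c := by
      rw [Finsupp.single_le_iff]
      lia
    obtain ⟨d, hd⟩ := exists_add_of_le hle
    have hdeg := congrArg Finsupp.degree hd
    rw [map_add, Finsupp.degree_single] at hdeg
    obtain rfl : d = 0 := (Finsupp.degree_eq_zero_iff d).mp (by lia)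
    rw [add_zero] at hd
    exact hP ⟨q.1, q.2, by rw [hac, hd, digitExponent_single]⟩

end Digits

section Abelianization

open MvPolynomial

variable {p : ℕ} {F : Type*} [Field F]
variable {L : Type*} [LieRing L] [LieAlgebra F L] [RestrictedLieAlgebra p F L]
variable {n : ℕ} {e : Fin n → L} {ex : Fin n → ℕ} {X : (i : Fin n) → Fin (ex i) → L}

theorem GoodPresentation.eq_top (h : GoodPresentation p F L n e ex X) {S : Submodule F L}
    (hD : derivedP p F L ≤ S) (hS : ∀ i (j : Fin (ex i)), (pmap p F L)^[j] (e i) ∈ S) :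
    S = ⊤ := by
  have hmap : S.map (derivedP p F L).mkQ = ⊤ := by
    rw [eq_top_iff, ← h.2.1, Submodule.span_le]
    rintro _ ⟨q, rfl⟩
    exact ⟨_, hS q.1 q.2, rfl⟩
  refine eq_top_iff.mpr fun x _ => ?_
  obtain ⟨s, hs, hsx⟩ : (derivedP p F L).mkQ x ∈ S.map (derivedP p F L).mkQ :=
    hmap ▸ Submodule.mem_top
  have hsub := hD ((Submodule.Quotient.eq _).mp hsx)
  simpa using S.sub_mem hs hsub

/-- The linear map `L → F[x_i]/(x_i ^ (p ^ ex i))` which vanishes on `L'_p` and sends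
`e_i^[p]^j` to `x_i ^ (p ^ j)`. -/
noncomputable def abelLin (h : GoodPresentation p F L n e ex X) : L →ₗ[F] TruncPoly p F ex :=
  ((Module.Basis.mk h.1 h.2.1.ge).constr F fun q =>
    TruncPoly.mk p F ex (MvPolynomial.X q.1) ^ p ^ (q.2 : ℕ)) ∘ₗ (derivedP p F L).mkQ

theorem abelLin_eq_zero (h : GoodPresentation p F L n e ex X) {x : L}
    (hx : x ∈ derivedP p F L) : abelLin h x = 0 := by
  rw [abelLin, LinearMap.comp_apply, Submodule.mkQ_apply, (Submodule.Quotient.mk_eq_zero _).mpr hx,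
    map_zero]

theorem abelLin_iterate (h : GoodPresentation p F L n e ex X) (i : Fin n) (j : Fin (ex i)) :
    abelLin h ((pmap p F L)^[j] (e i)) = TruncPoly.mk p F ex (MvPolynomial.X i) ^ p ^ (j : ℕ) := by
  have hb := (Module.Basis.mk h.1 h.2.1.ge).constr_basis F (fun q : Σ i, Fin (ex i) =>
    TruncPoly.mk p F ex (MvPolynomial.X q.1) ^ p ^ (q.2 : ℕ)) ⟨i, j⟩
  rwa [Module.Basis.mk_apply] at hb

theorem abelLin_lie (h : GoodPresentation p F L n e ex X) (x y : L) : abelLin h ⁅x, y⁆ = 0 := by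
  refine abelLin_eq_zero h (derivedSub_le_derivedP p F L ?_)
  rw [derivedSub_eq_span]
  exact Submodule.subset_span ⟨x, y, rfl⟩

variable [hp : Fact p.Prime] [CharP F p]

theorem abelLin_pmap (h : GoodPresentation p F L n e ex X) (x : L) :
    abelLin h (pmap p F L x) = abelLin h x ^ p := by
  have hpow : ∀ a b : TruncPoly p F ex, (a + b) ^ p = a ^ p + b ^ p := fun a b => by
    simpa using TruncPoly.add_pow_prime_pow a b 1
  let S : Submodule F L :=
    { carrier := {x | abelLin h (pmap p F L x) = abelLin h x ^ p}
      add_mem' := fun {x y} hx hy => by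
        rw [Set.mem_ofPred_eq] at hx hy ⊢
        rw [map_pmap_add _ (abelLin_lie h), map_add, hx, hy, hpow]
      zero_mem' := by
        have h0 : pmap p F L (0 : L) = 0 := by
          simpa [zero_pow hp.out.ne_zero] using
            RestrictedLieAlgebra.pOp_smul (p := p) (0 : F) (0 : L)
        rw [Set.mem_ofPred_eq, h0, map_zero, zero_pow hp.out.ne_zero]
      smul_mem' := fun c x hx => by
        rw [Set.mem_ofPred_eq] at hx ⊢
        rw [pmap, RestrictedLieAlgebra.pOp_smul, map_smul, map_smul, smul_pow, ← hx] }
  have hS : S = ⊤ := by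
    refine h.eq_top (fun y hy => ?_) fun i j => ?_
    · change abelLin h (pmap p F L y) = abelLin h y ^ p
      rw [abelLin_eq_zero h hy, abelLin_eq_zero h (pmap_mem_derivedP hy),
        zero_pow hp.out.ne_zero]
    · change abelLin h (pmap p F L ((pmap p F L)^[j] (e i))) =
        abelLin h ((pmap p F L)^[j] (e i)) ^ p
      rw [abelLin_iterate, ← pow_mul, ← pow_succ, ← Function.iterate_succ_apply' (pmap p F L),
        Nat.succ_eq_add_one]
      rcases Nat.lt_or_ge (j + 1) (ex i) with hj | hj
      · exact abelLin_iterate h i ⟨j + 1, hj⟩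
      · obtain hj : (j : ℕ) + 1 = ex i := by lia
        rw [hj, TruncPoly.mk_X_pow_eq_zero p F ex le_rfl]
        exact abelLin_eq_zero h (h.2.2.1 i)
  exact (hS ▸ Submodule.mem_top : x ∈ S)

/-- The abelianization `u(L) → F[x_i]/(x_i ^ (p ^ ex i))` of `u(L)`. -/
noncomputable def abel (h : GoodPresentation p F L n e ex X) : uEnv p F L →ₐ[F] TruncPoly p F ex :=
  uLift (abelLin h) (abelLin_lie h) (abelLin_pmap h)

theorem abel_uemb (h : GoodPresentation p F L n e ex X) (x : L) :
    abel h (uemb p F L x) = abelLin h x :=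
  uLift_uemb ..

theorem abel_uemb_generator (h : GoodPresentation p F L n e ex X) (i : Fin n) :
    abel h (uemb p F L (e i)) = TruncPoly.mk p F ex (MvPolynomial.X i) := by
  rw [abel_uemb]
  rcases Nat.eq_zero_or_pos (ex i) with hi | hi
  · have h0 := TruncPoly.mk_X_pow_eq_zero p F ex (i := i) (k := 1) (by simp [hi])
    have he := h.2.2.1 i
    rw [hi, Function.iterate_zero, id] at he
    rw [abelLin_eq_zero h he, ← h0, pow_one]
  · simpa using abelLin_iterate h i ⟨0, hi⟩

theorem abel_uemb_representative (h : GoodPresentation p F L n e ex X) (i : Fin n)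
    (j : Fin (ex i)) :
    abel h (uemb p F L (X i j)) = TruncPoly.mk p F ex (MvPolynomial.X i) ^ p ^ (j : ℕ) := by
  have hX := abelLin_eq_zero h (h.2.2.2 i j)
  rw [map_sub, sub_eq_zero] at hX
  rw [abel_uemb, hX, abelLin_iterate]

/-- Homomorphisms from `u(L)` to commutative algebras factor through the abelianization. -/
theorem exists_comp_abel_eq (h : GoodPresentation p F L n e ex X) {C : Type*} [CommRing C]
    [Algebra F C] (χ : uEnv p F L →ₐ[F] C) :
    ∃ τ : TruncPoly p F ex →ₐ[F] C, τ.comp (abel h) = χ := by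
  refine ⟨TruncPoly.lift p F ex (fun i => χ (uemb p F L (e i))) fun i => ?_,
    uEnv_algHom_ext fun x => ?_⟩
  · rw [← map_pow, ← uemb_pmap_iterate]
    exact algHom_uemb_eq_zero hp.out.ne_zero χ (h.2.2.1 i)
  · set τ := TruncPoly.lift p F ex (fun i => χ (uemb p F L (e i))) _
    have hS : LinearMap.eqLocus ((τ.comp (abel h)).toLinearMap ∘ₗ uemb p F L)
        (χ.toLinearMap ∘ₗ uemb p F L) = ⊤ := by
      refine h.eq_top (fun y hy => ?_) fun i j => ?_
      · exact (algHom_uemb_eq_zero hp.out.ne_zero (τ.comp (abel h)) hy).trans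
          (algHom_uemb_eq_zero hp.out.ne_zero χ hy).symm
      · change τ (abel h (uemb p F L _)) = χ (uemb p F L _)
        rw [uemb_pmap_iterate, map_pow, map_pow, map_pow, abel_uemb_generator, TruncPoly.lift_mk,
          aeval_X]
    exact (hS ▸ Submodule.mem_top : x ∈ LinearMap.eqLocus ((τ.comp (abel h)).toLinearMap ∘ₗ
      uemb p F L) (χ.toLinearMap ∘ₗ uemb p F L))

theorem mem_commutatorIdeal_of_abel_eq_zero (h : GoodPresentation p F L n e ex X)
    {u : uEnv p F L} (hu : abel h u = 0) : u ∈ commutatorIdeal F (uEnv p F L) := by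
  obtain ⟨τ, hτ⟩ := exists_comp_abel_eq h (toCommQuotient F (uEnv p F L))
  refine mem_commutatorIdeal_of_toCommQuotient_eq_zero ?_
  rw [← hτ, AlgHom.comp_apply, hu, map_zero]

theorem aug_abel (h : GoodPresentation p F L n e ex X) (u : uEnv p F L) :
    TruncPoly.aug p F ex (abel h u) = aug p F L u := by
  suffices hext : (TruncPoly.aug p F ex).comp (abel h) = aug p F L from DFunLike.congr_fun hext u
  refine uEnv_algHom_ext ?_
  have hS : LinearMap.ker (((TruncPoly.aug p F ex).comp (abel h)).toLinearMap ∘ₗ uemb p F L) =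
      ⊤ := by
    refine h.eq_top (fun y hy => ?_) fun i j => ?_
    · exact algHom_uemb_eq_zero hp.out.ne_zero ((TruncPoly.aug p F ex).comp (abel h)) hy
    · change TruncPoly.aug p F ex (abel h (uemb p F L _)) = 0
      rw [uemb_pmap_iterate, map_pow, map_pow, abel_uemb_generator, TruncPoly.aug_mk,
        constantCoeff_X, zero_pow (pow_ne_zero _ hp.out.ne_zero)]
  intro x
  rw [aug_uemb]
  exact (hS ▸ Submodule.mem_top : x ∈ LinearMap.ker
    (((TruncPoly.aug p F ex).comp (abel h)).toLinearMap ∘ₗ uemb p F L))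

end Abelianization

end RestrictedLieAlgebra

namespace RestrictedLieAlgebra

section Monomials

open MvPolynomial

variable {p : ℕ} {F : Type*} [Field F] [hp : Fact p.Prime]
variable {L : Type*} [LieRing L] [LieAlgebra F L] [RestrictedLieAlgebra p F L]
variable {n : ℕ} {e : Fin n → L} {ex : Fin n → ℕ} {X : (i : Fin n) → Fin (ex i) → L}

variable (p F X) in
/-- The PBW monomial in the representatives `X i j` with exponents `a i j`. -/
noncomputable def pbwMonomial (a : (i : Fin n) → Fin (ex i) → ℕ) : uEnv p F L :=
  ((List.finRange n).map fun i =>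
    ((List.finRange (ex i)).map fun j => uemb p F L (X i j) ^ a i j).prod).prod

variable (p) in
/-- The exponents of the PBW monomials of degree at least two. -/
abbrev PBWExponent (ex : Fin n → ℕ) : Type :=
  {a : (i : Fin n) → Fin (ex i) → ℕ // (∀ i j, a i j < p) ∧ 2 ≤ ∑ i, ∑ j, a i j}

variable (p F X) in
theorem eSpace_eq_sup_span_range : eSpace p F L n ex X = jIdeal p F L ⊔
    Submodule.span F (Set.range fun a : PBWExponent p ex => pbwMonomial p F X a.1) := by
  rw [eSpace]
  congr 2
  ext u
  constructor
  · rintro ⟨a, ha, h2, rfl⟩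
    exact ⟨⟨a, ha, h2⟩, rfl⟩
  · rintro ⟨⟨a, ha, h2⟩, rfl⟩
    exact ⟨a, ha, h2, rfl⟩

variable [CharP F p]

theorem abel_pbwMonomial (h : GoodPresentation p F L n e ex X) (a : (i : Fin n) → Fin (ex i) → ℕ) :
    abel h (pbwMonomial p F X a) = TruncPoly.mk p F ex (monomial (digitExponent p a) 1) := by
  have hrow : ∀ i, abel h ((List.finRange (ex i)).map fun j => uemb p F L (X i j) ^ a i j).prod =
      TruncPoly.mk p F ex (MvPolynomial.X i) ^ digitExponent p a i := by
    intro i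
    rw [map_list_prod, List.map_map, ← Fin.prod_univ_def, digitExponent_apply,
      ← Finset.prod_pow_eq_pow_sum]
    refine Finset.prod_congr rfl fun j _ => ?_
    rw [Function.comp_apply, map_pow, abel_uemb_representative, ← pow_mul, mul_comm]
  rw [pbwMonomial, map_list_prod, List.map_map, ← Fin.prod_univ_def, monomial_eq, C_1, one_mul,
    Finsupp.prod_fintype _ _ fun i => pow_zero _, map_prod]
  exact Finset.prod_congr rfl fun i _ => (hrow i).trans (map_pow ..).symm

theorem abel_eq_zero_of_mem_jIdeal (h : GoodPresentation p F L n e ex X) {u : uEnv p F L}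
    (hu : u ∈ jIdeal p F L) : abel h u = 0 :=
  commutatorIdeal_le_ker (abel h) (jIdeal_le_commutatorIdeal p F L hu)

theorem linearIndependent_abel_pbwMonomial (h : GoodPresentation p F L n e ex X) :
    LinearIndependent F fun a : PBWExponent p ex => abel h (pbwMonomial p F X a.1) := by
  simp only [abel_pbwMonomial]
  refine (TruncPoly.linearIndependent_monomial p F ex).comp
    (fun a : PBWExponent p ex => ⟨digitExponent p a.1, digitExponent_lt a.2.1⟩) ?_
  exact fun a b hab =>
    Subtype.ext (digitExponent_injective a.2.1 b.2.1 (congrArg Subtype.val hab))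

/-- The abelianization is injective on `E` modulo `J_L`. -/
theorem mem_jIdeal_of_mem_eSpace (h : GoodPresentation p F L n e ex X) {u : uEnv p F L}
    (hu : u ∈ eSpace p F L n ex X) (h0 : abel h u = 0) : u ∈ jIdeal p F L := by
  rw [eSpace_eq_sup_span_range] at hu
  obtain ⟨j, hj, m, hm, rfl⟩ := Submodule.mem_sup.mp hu
  rw [map_add, abel_eq_zero_of_mem_jIdeal h hj, zero_add] at h0
  have hdis := Submodule.range_ker_disjoint (f := (abel h).toLinearMap)
    (linearIndependent_abel_pbwMonomial h)
  obtain rfl := Submodule.disjoint_def.mp hdis m hm h0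
  rwa [add_zero]

theorem pPowProj_abel_of_mem_eSpace (h : GoodPresentation p F L n e ex X) {u : uEnv p F L}
    (hu : u ∈ eSpace p F L n ex X) : pPowProj p F ex (abel h u) = 0 := by
  have hle : eSpace p F L n ex X ≤
      LinearMap.ker (pPowProj p F ex ∘ₗ (abel h).toLinearMap) := by
    rw [eSpace_eq_sup_span_range]
    refine sup_le (fun j hj => ?_) (Submodule.span_le.mpr ?_)
    · simp [abel_eq_zero_of_mem_jIdeal h hj]
    · rintro _ ⟨a, rfl⟩
      change pPowProj p F ex (abel h _) = 0
      rw [abel_pbwMonomial, pPowProj_mk, pPowProjAux_monomial,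
        if_neg (not_isPPowExponent_digitExponent a.2.1 a.2.2), map_zero]
  exact hle hu

theorem eSpace_le_omegaIdeal (h : GoodPresentation p F L n e ex X) :
    eSpace p F L n ex X ≤ omegaIdeal p F L := by
  rw [eSpace_eq_sup_span_range]
  refine sup_le (jIdeal_le_omegaIdeal p F L) (Submodule.span_le.mpr ?_)
  rintro _ ⟨a, rfl⟩
  have h0 : digitExponent p a.1 ≠ 0 := by
    intro h0
    have ha : a.1 = fun _ _ => 0 := by
      refine digitExponent_injective a.2.1 (fun _ _ => hp.out.pos) (h0.trans ?_)
      ext i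
      simp [digitExponent_apply]
    have h2 := a.2.2
    simp [ha] at h2
  rw [SetLike.mem_coe, mem_omegaIdeal, ← aug_abel h, abel_pbwMonomial, TruncPoly.aug_mk,
    constantCoeff_monomial, if_neg h0]

theorem exists_mem_eSpace_abel_eq (h : GoodPresentation p F L n e ex X) {t : TruncPoly p F ex}
    (haug : TruncPoly.aug p F ex t = 0) (hproj : pPowProj p F ex t = 0) :
    ∃ u ∈ eSpace p F L n ex X, abel h u = t := by
  have key : ∀ f : MvPolynomial (Fin n) F, TruncPoly.mk p F ex f -
      pPowProj p F ex (TruncPoly.mk p F ex f) - algebraMap F _ (constantCoeff f) ∈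
        (eSpace p F L n ex X).map (abel h).toLinearMap := by
    intro f
    induction f using MvPolynomial.induction_on' with
    | monomial s c =>
      rw [pPowProj_mk, pPowProjAux_monomial, constantCoeff_monomial]
      split_ifs with hP h0 h0
      · exact absurd h0 hP.ne_zero
      · simp
      · subst h0
        rw [map_zero, sub_zero]
        convert Submodule.zero_mem _
        rw [sub_eq_zero]
        exact (TruncPoly.mk p F ex).commutes c
      · rw [map_zero, map_zero, sub_zero, sub_zero]
        by_cases hs : ∀ i, s i < p ^ ex i
        · obtain ⟨a, ha, rfl⟩ := exists_digitExponent_eq hs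
          refine ⟨c • pbwMonomial p F X a, Submodule.smul_mem _ _ ?_, ?_⟩
          · rw [eSpace_eq_sup_span_range]
            exact Submodule.mem_sup_right (Submodule.subset_span
              ⟨⟨a, ha, two_le_sum_of_not_isPPowExponent h0 hP⟩, rfl⟩)
          · change abel h (c • _) = _
            rw [map_smul, abel_pbwMonomial, ← map_smul, smul_monomial, smul_eq_mul, mul_one]
        · push Not at hs
          obtain ⟨i, hi⟩ := hs
          rw [TruncPoly.mk_monomial_eq_zero p F ex hi]
          exact Submodule.zero_mem _
    | add f g hf hg =>
      convert Submodule.add_mem _ hf hg using 1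
      simp only [map_add]
      abel
  obtain ⟨f, rfl⟩ := TruncPoly.mk_surjective p F ex t
  have hf := key f
  rw [TruncPoly.aug_mk] at haug
  rwa [hproj, haug, map_zero, sub_zero, sub_zero] at hf

end Monomials

end RestrictedLieAlgebra

namespace RestrictedLieAlgebra

section Isomorphism

variable {p : ℕ} {F : Type*} [Field F] [hp : Fact p.Prime] [CharP F p]
variable {L : Type*} [LieRing L] [LieAlgebra F L] [RestrictedLieAlgebra p F L]
variable {H : Type*} [LieRing H] [LieAlgebra F H] [RestrictedLieAlgebra p F H]
variable {n : ℕ} {e : Fin n → L} {ex : Fin n → ℕ} {X : (i : Fin n) → Fin (ex i) → L}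

section Linear

variable (h : GoodPresentation p F L n e ex X) (φ : uEnv p F L ≃ₐ[F] uEnv p F H)

/-- The linear map from `H` to truncated polynomials given by `φ⁻¹`, abelianization and
projection to the span of the `x_i ^ (p ^ j)`. -/
noncomputable def pPowLin : H →ₗ[F] TruncPoly p F ex :=
  pPowProj p F ex ∘ₗ (abel h).toLinearMap ∘ₗ φ.symm.toLinearMap ∘ₗ uemb p F H

theorem pPowLin_apply (x : H) :
    pPowLin h φ x = pPowProj p F ex (abel h (φ.symm (uemb p F H x))) :=
  rfl

theorem pPowLin_lie (x y : H) : pPowLin h φ ⁅x, y⁆ = 0 := by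
  rw [pPowLin_apply, uemb_lie, map_sub, map_sub, map_mul, map_mul, map_mul, map_mul, mul_comm,
    sub_self, map_zero]

theorem pPowLin_pmap (x : H) : pPowLin h φ (pmap p F H x) = pPowLin h φ x ^ p := by
  rw [pPowLin_apply, uemb_pmap, map_pow, map_pow, pPowProj_pow, pPowLin_apply]

theorem pPowLin_pmap_iterate (x : H) (j : ℕ) :
    pPowLin h φ ((pmap p F H)^[j] x) = pPowLin h φ x ^ p ^ j := by
  induction j with
  | zero => simp
  | succ j ih => rw [Function.iterate_succ_apply', pPowLin_pmap, ih, ← pow_mul, pow_succ]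

end Linear

theorem pPowProj_abel_mem_of_mem_sq (h : GoodPresentation p F L n e ex X) {w : uEnv p F L}
    (hw : w ∈ omegaIdeal p F L * omegaIdeal p F L) :
    pPowProj p F ex (abel h w) ∈ Submodule.span F
      {u | ∃ i j, 1 ≤ j ∧ u = TruncPoly.mk p F ex (MvPolynomial.X i) ^ p ^ j} := by
  refine (Submodule.mul_le (P := (Submodule.span F
    {u | ∃ i j, 1 ≤ j ∧ u = TruncPoly.mk p F ex (MvPolynomial.X i) ^ p ^ j}).comap
      (pPowProj p F ex ∘ₗ (abel h).toLinearMap))).mpr (fun a ha b hb => ?_) hw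
  rw [Submodule.mem_comap, LinearMap.comp_apply, AlgHom.toLinearMap_apply, map_mul]
  exact pPowProj_mul_mem p F ((aug_abel h a).trans ha) ((aug_abel h b).trans hb)

theorem pow_mem_span_of_mem_span {t : TruncPoly p F ex} {m j : ℕ}
    (ht : t ∈ Submodule.span F
      {u | ∃ i k, m ≤ k ∧ u = TruncPoly.mk p F ex (MvPolynomial.X i) ^ p ^ k}) :
    t ^ p ^ j ∈ Submodule.span F
      {u | ∃ i k, m + j ≤ k ∧ u = TruncPoly.mk p F ex (MvPolynomial.X i) ^ p ^ k} := by
  induction ht using Submodule.span_induction with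
  | mem _ hu =>
    obtain ⟨i, k, hk, rfl⟩ := hu
    refine Submodule.subset_span ⟨i, k + j, by lia, ?_⟩
    rw [← pow_mul, pow_add]
  | zero => simp [zero_pow (pow_ne_zero j hp.out.ne_zero)]
  | add a b _ _ ha hb =>
    rw [TruncPoly.add_pow_prime_pow]
    exact Submodule.add_mem _ ha hb
  | smul c a _ ha =>
    rw [smul_pow]
    exact Submodule.smul_mem _ _ ha

theorem exists_sub_pPowLin_mem (h : GoodPresentation p F L n e ex X)
    (φ : uEnv p F L ≃ₐ[F] uEnv p F H)
    (hω : (omegaIdeal p F L).map φ.toLinearMap = omegaIdeal p F H) (i : Fin n) :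
    ∃ x : H, TruncPoly.mk p F ex (MvPolynomial.X i) - pPowLin h φ x ∈ Submodule.span F
      {u | ∃ i j, 1 ≤ j ∧ u = TruncPoly.mk p F ex (MvPolynomial.X i) ^ p ^ j} := by
  have hmem : φ (uemb p F L (e i)) ∈ omegaIdeal p F H := by
    rw [← hω]
    exact Submodule.mem_map_of_mem (aug_uemb p F L (e i))
  obtain ⟨_, ⟨x, rfl⟩, w, hw, hxw⟩ := Submodule.mem_sup.mp (omegaIdeal_le_lSub_sup_sq p F H hmem)
  have hsq : omegaIdeal p F H * omegaIdeal p F H =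
      (omegaIdeal p F L * omegaIdeal p F L).map φ.toLinearMap := by
    rw [← hω]
    exact (Submodule.map_mul _ _ φ.toAlgHom).symm
  rw [hsq] at hw
  obtain ⟨w, hw, rfl⟩ := hw
  refine ⟨x, ?_⟩
  have hx : φ.symm (uemb p F H x) = uemb p F L (e i) - w := by
    rw [eq_sub_iff_add_eq, ← φ.symm_apply_apply (uemb p F L (e i)), ← hxw, map_add]
    simp
  rw [pPowLin_apply, hx, map_sub, map_sub, abel_uemb_generator, pPowProj_X, sub_sub_cancel]
  exact pPowProj_abel_mem_of_mem_sq h hw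

theorem X_pow_mem_range_pPowLin (h : GoodPresentation p F L n e ex X)
    (φ : uEnv p F L ≃ₐ[F] uEnv p F H)
    (hω : (omegaIdeal p F L).map φ.toLinearMap = omegaIdeal p F H) (i : Fin n) (j : ℕ) :
    TruncPoly.mk p F ex (MvPolynomial.X i) ^ p ^ j ∈ LinearMap.range (pPowLin h φ) := by
  have key : ∀ d j, ∑ i, ex i ≤ j + d → ∀ i,
      TruncPoly.mk p F ex (MvPolynomial.X i) ^ p ^ j ∈ LinearMap.range (pPowLin h φ) := by
    intro d
    induction d with
    | zero =>
      intro j hj i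
      rw [add_zero] at hj
      rw [TruncPoly.mk_X_pow_eq_zero p F ex (Nat.pow_le_pow_right hp.out.pos
        ((Finset.single_le_sum (fun _ _ => Nat.zero_le _) (Finset.mem_univ i)).trans hj))]
      exact Submodule.zero_mem _
    | succ d ih =>
      intro j hj i
      obtain ⟨x, hx⟩ := exists_sub_pPowLin_mem h φ hω i
      have hpow := pow_mem_span_of_mem_span (j := j) hx
      have hle : Submodule.span F
          {u | ∃ i k, 1 + j ≤ k ∧ u = TruncPoly.mk p F ex (MvPolynomial.X i) ^ p ^ k} ≤
          LinearMap.range (pPowLin h φ) := by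
        refine Submodule.span_le.mpr ?_
        rintro _ ⟨i, k, hk, rfl⟩
        exact ih k (by lia) i
      rw [← sub_add_cancel (TruncPoly.mk p F ex (MvPolynomial.X i)) (pPowLin h φ x),
        TruncPoly.add_pow_prime_pow, ← pPowLin_pmap_iterate]
      exact Submodule.add_mem _ (hle hpow) ⟨_, rfl⟩
  exact key _ j (Nat.le_add_left _ _) i

/-- The elements of `H` killed by `pPowLin` are already killed by the abelianization of `u(L)`. -/
theorem abel_symm_eq_zero_of_pPowLin_eq_zero (h : GoodPresentation p F L n e ex X)
    (φ : uEnv p F L ≃ₐ[F] uEnv p F H)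
    (hω : (omegaIdeal p F L).map φ.toLinearMap = omegaIdeal p F H)
    {x : H} (hx : pPowLin h φ x = 0) :
    abel h (φ.symm (uemb p F H x)) = 0 := by
  let Ψ := uLift (pPowLin h φ) (pPowLin_lie h φ) (pPowLin_pmap h φ)
  obtain ⟨τ, hτ⟩ := exists_comp_abel_eq h (Ψ.comp (φ : uEnv p F L →ₐ[F] uEnv p F H))
  have hτ' : ∀ y : H, τ (abel h (φ.symm (uemb p F H y))) = pPowLin h φ y := by
    intro y
    refine (DFunLike.congr_fun hτ (φ.symm (uemb p F H y))).trans ?_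
    refine (congrArg Ψ (φ.apply_symm_apply (uemb p F H y))).trans (uLift_uemb ..)
  have hsurj : Function.Surjective τ := by
    have hX : ∀ i, ∃ t, τ t = TruncPoly.mk p F ex (MvPolynomial.X i) := by
      intro i
      obtain ⟨y, hy⟩ := X_pow_mem_range_pPowLin h φ hω i 0
      rw [pow_zero, pow_one] at hy
      exact ⟨_, (hτ' y).trans hy⟩
    intro t
    obtain ⟨f, rfl⟩ := TruncPoly.mk_surjective p F ex t
    rw [← AlgHom.mem_range]
    induction f using MvPolynomial.induction_on with
    | C c => exact ⟨algebraMap F _ c, (τ.commutes c).trans ((TruncPoly.mk p F ex).commutes c).symm⟩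
    | add f g hf hg =>
      rw [map_add]
      exact add_mem hf hg
    | mul_X f i hf =>
      rw [map_mul]
      exact mul_mem hf (hX i)
  have hinj : Function.Injective τ.toLinearMap :=
    LinearMap.injective_iff_surjective.mpr hsurj
  exact hinj (((hτ' _).trans hx).trans (map_zero τ).symm)

theorem pPowProj_mem_range_pPowLin (h : GoodPresentation p F L n e ex X)
    (φ : uEnv p F L ≃ₐ[F] uEnv p F H)
    (hω : (omegaIdeal p F L).map φ.toLinearMap = omegaIdeal p F H) (t : TruncPoly p F ex) :
    pPowProj p F ex t ∈ LinearMap.range (pPowLin h φ) := by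
  obtain ⟨f, rfl⟩ := TruncPoly.mk_surjective p F ex t
  exact pPowProj_mk_mem p F fun i j _ => X_pow_mem_range_pPowLin h φ hω i j

theorem map_eSpace_le_omegaIdeal (h : GoodPresentation p F L n e ex X)
    (φ : uEnv p F L ≃ₐ[F] uEnv p F H)
    (hω : (omegaIdeal p F L).map φ.toLinearMap = omegaIdeal p F H) :
    (eSpace p F L n ex X).map φ.toLinearMap ≤ omegaIdeal p F H :=
  hω ▸ Submodule.map_mono (eSpace_le_omegaIdeal h)

theorem omegaIdeal_eq_sup_map_eSpace (h : GoodPresentation p F L n e ex X)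
    (φ : uEnv p F L ≃ₐ[F] uEnv p F H)
    (hω : (omegaIdeal p F L).map φ.toLinearMap = omegaIdeal p F H) :
    lSub p F H ⊔ jIdeal p F H ⊔ (eSpace p F L n ex X).map φ.toLinearMap = omegaIdeal p F H := by
  refine le_antisymm (sup_le (sup_le (lSub_le_omegaIdeal p F H) (jIdeal_le_omegaIdeal p F H))
    (map_eSpace_le_omegaIdeal h φ hω)) ?_
  intro v hv
  obtain ⟨x, hx⟩ := pPowProj_mem_range_pPowLin h φ hω (abel h (φ.symm v))
  have hsub : v - uemb p F H x ∈ omegaIdeal p F H :=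
    Submodule.sub_mem _ hv (aug_uemb p F H x)
  have hsub' : φ.symm (v - uemb p F H x) ∈ omegaIdeal p F L := by
    rw [← hω] at hsub
    obtain ⟨w, hw, hwv⟩ := hsub
    rw [← hwv]
    simpa using hw
  obtain ⟨u, hu, hux⟩ := exists_mem_eSpace_abel_eq h ((aug_abel h _).trans hsub')
    (by rw [map_sub, map_sub, map_sub, ← hx, pPowLin_apply, sub_self])
  have hcomm : v - uemb p F H x - φ u ∈ commutatorIdeal F (uEnv p F H) := by
    rw [← map_commutatorIdeal φ]
    refine ⟨φ.symm (v - uemb p F H x) - u,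
      mem_commutatorIdeal_of_abel_eq_zero h (by rw [map_sub, hux, sub_self]), ?_⟩
    simp
  have hv' : v = uemb p F H x + (v - uemb p F H x - φ u) + φ u := by abel
  rw [hv']
  exact Submodule.add_mem_sup (Submodule.add_mem _ (Submodule.mem_sup_left ⟨x, rfl⟩)
    (commutatorIdeal_le_lSub_sup_jIdeal p F H hcomm)) ⟨u, hu, rfl⟩

theorem mem_jIdeal_of_symm_mem_eSpace (h : GoodPresentation p F L n e ex X)
    (φ : uEnv p F L ≃ₐ[F] uEnv p F H)
    (hω : (omegaIdeal p F L).map φ.toLinearMap = omegaIdeal p F H) {x : H}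
    (hx : φ.symm (uemb p F H x) ∈ eSpace p F L n ex X) : uemb p F H x ∈ jIdeal p F H := by
  have h0 := abel_symm_eq_zero_of_pPowLin_eq_zero h φ hω (pPowProj_abel_of_mem_eSpace h hx)
  rw [← map_jIdeal φ hω]
  exact ⟨_, mem_jIdeal_of_mem_eSpace h hx h0, φ.apply_symm_apply _⟩

end Isomorphism

end RestrictedLieAlgebra

open RestrictedLieAlgebra in
/-- With `E ⊆ u(L)` as in the running setup and `φ : u(L) → u(H)` an algebra
isomorphism preserving augmentation ideals, one has
`ω(H)/J_H = (H + J_H)/J_H ⊕ φ(E)/J_H`. -/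
theorem omegaH_decomposition
    (p : ℕ) (F L H : Type*) [Field F] [Fact p.Prime] [CharP F p] [PerfectField F]
    [LieRing L] [LieAlgebra F L] [RestrictedLieAlgebra p F L]
    [LieRing H] [LieAlgebra F H] [RestrictedLieAlgebra p F H]
    [FiniteDimensional F L] [FiniteDimensional F H]
    (hL : IsPNilpotent p F L) (hH : IsPNilpotent p F H)
    (n : ℕ) (e : Fin n → L) (ex : Fin n → ℕ) (X : (i : Fin n) → Fin (ex i) → L)
    (hpres : GoodPresentation p F L n e ex X)
    (φ : uEnv p F L ≃ₐ[F] uEnv p F H)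
    (hω : (omegaIdeal p F L).map φ.toLinearMap = omegaIdeal p F H) :
    Disjoint ((lSub p F H ⊔ jIdeal p F H).map (jIdeal p F H).mkQ)
        (((eSpace p F L n ex X).map φ.toLinearMap).map (jIdeal p F H).mkQ) ∧
      ((lSub p F H ⊔ jIdeal p F H).map (jIdeal p F H).mkQ ⊔
          ((eSpace p F L n ex X).map φ.toLinearMap).map (jIdeal p F H).mkQ)
        = (omegaIdeal p F H).map (jIdeal p F H).mkQ := by
  refine ⟨?_, by rw [← Submodule.map_sup, omegaIdeal_eq_sup_map_eSpace hpres φ hω]⟩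
  rw [Submodule.disjoint_def]
  rintro _ ⟨v, hv, rfl⟩ ⟨_, ⟨u, hu, rfl⟩, huv⟩
  rw [Submodule.mkQ_apply, Submodule.Quotient.mk_eq_zero]
  obtain ⟨_, ⟨x, rfl⟩, j, hj, rfl⟩ := Submodule.mem_sup.mp hv
  refine Submodule.add_mem _ (mem_jIdeal_of_symm_mem_eSpace hpres φ hω ?_) hj
  have hsub := (Submodule.Quotient.eq _).mp huv
  have hdiff : φ u - uemb p F H x ∈ jIdeal p F H := by
    have := Submodule.add_mem _ hsub hj
    rwa [sub_add_eq_sub_sub, sub_add_cancel] at this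
  rw [← map_jIdeal φ hω] at hdiff
  obtain ⟨k, hk, hku⟩ := hdiff
  have hx : φ.symm (uemb p F H x) = u - k := by
    rw [← φ.symm_apply_apply (u - k), map_sub]
    exact congrArg φ.symm (by rw [show φ k = φ u - uemb p F H x from hku, sub_sub_cancel])
  rw [hx]
  exact Submodule.sub_mem _ hu (Submodule.mem_sup_left hk)
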